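/- Let B ∈ ℝ^{N×N}, and let σ_1 ≥ σ_2 ≥ ... ≥ σ_N ≥ 0 denote its singular values in nonincreasing order (so that σ_i² are the eigenvalues of Bᵀ B in nonincreasing order with multiplicity). Then for every k ≤ N and every matrix X ∈ ℝ^{N×N} with rank(X) ≤ k, one has ‖B − X‖_F² ≥ ∑_{i=k+1}^N σ_i². Moreover, there exists a matrix B* ∈ ℝ^{N×N} with rank(B*) ≤ k such that ‖B − B*‖_F² = ∑_{i=k+1}^N σ_i²; hence the minimum of ‖B − X‖_F over matrices of rank at most k equals √(∑_{i=k+1}^N σ_i²). -/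

import Mathlib

open Matrix BigOperators

/-- Frobenius norm of a real matrix: `‖A‖_F = √(tr (A * Aᵀ))`. -/
noncomputable def frob {n m : ℕ} (A : Matrix (Fin n) (Fin m) ℝ) : ℝ :=
  Real.sqrt (Matrix.trace (A * Aᵀ))

/-- Squared Frobenius norm of a real matrix: `‖A‖_F² = tr (A * Aᵀ)`. -/
noncomputable def frobSq {n m : ℕ} (A : Matrix (Fin n) (Fin m) ℝ) : ℝ :=
  Matrix.trace (A * Aᵀ)

lemma frobSq_nonneg {n m : ℕ} (A : Matrix (Fin n) (Fin m) ℝ) : 0 ≤ frobSq A := by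
  simp only [frobSq, trace, diag_apply, mul_apply, transpose_apply]
  exact Finset.sum_nonneg fun i _ => Finset.sum_nonneg fun j _ => mul_self_nonneg _

/-- The Frobenius norm after right multiplication by an orthogonal projection. -/
lemma frobSq_mul_of_isIdempotentElem {n m : ℕ} (A : Matrix (Fin n) (Fin m) ℝ)
    {P : Matrix (Fin m) (Fin m) ℝ} (hPs : Pᵀ = P) (hPi : P * P = P) :
    frobSq (A * P) = trace (Aᵀ * A * P) := by
  rw [frobSq, transpose_mul, hPs, Matrix.mul_assoc, ← Matrix.mul_assoc P, hPi,
    ← Matrix.mul_assoc, trace_mul_comm, ← Matrix.mul_assoc]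

/-- Right multiplication by an orthogonal projection does not increase the Frobenius norm. -/
lemma frobSq_mul_le_of_isIdempotentElem {n m : ℕ} (A : Matrix (Fin n) (Fin m) ℝ)
    {P : Matrix (Fin m) (Fin m) ℝ} (hPs : Pᵀ = P) (hPi : P * P = P) :
    frobSq (A * P) ≤ frobSq A := by
  have h := frobSq_nonneg (A * (1 - P))
  rw [frobSq_mul_of_isIdempotentElem A (by simp [hPs])
    (by simp [Matrix.mul_sub, Matrix.sub_mul, hPi]), Matrix.mul_sub, trace_sub,
    ← frobSq_mul_of_isIdempotentElem A hPs hPi, Matrix.mul_one, trace_mul_comm] at h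
  simpa [frobSq] using h

/-- The orthogonal projection onto the kernel of a square matrix. -/
lemma exists_projection_onto_ker {N : ℕ} (X : Matrix (Fin N) (Fin N) ℝ) :
    ∃ P : Matrix (Fin N) (Fin N) ℝ, Pᵀ = P ∧ P * P = P ∧ X * P = 0 ∧
      P.trace = N - X.rank := by
  have hA : (Xᵀ * X).IsHermitian := isHermitian_conjTranspose_mul_self X
  set U : Matrix (Fin N) (Fin N) ℝ := (hA.eigenvectorUnitary : Matrix (Fin N) (Fin N) ℝ)
  have hU : Uᵀ * U = 1 := Unitary.coe_star_mul_self hA.eigenvectorUnitary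
  have hspec : Xᵀ * X = U * diagonal hA.eigenvalues * Uᵀ := hA.spectral_theorem
  set d : Fin N → ℝ := fun i => if hA.eigenvalues i = 0 then 1 else 0
  have conj_mul : ∀ a b : Fin N → ℝ, (U * diagonal a * Uᵀ) * (U * diagonal b * Uᵀ)
      = U * diagonal (fun i => a i * b i) * Uᵀ := fun a b => by
    calc _ = U * diagonal a * (Uᵀ * U) * diagonal b * Uᵀ := by simp only [Matrix.mul_assoc]
      _ = _ := by rw [hU, Matrix.mul_one, Matrix.mul_assoc U, diagonal_mul_diagonal]
  refine ⟨U * diagonal d * Uᵀ, by simp [Matrix.mul_assoc], ?_, ?_, ?_⟩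
  · rw [conj_mul]
    congr 3
    funext i
    simp [d]
  · have h : Xᵀ * X * (U * diagonal d * Uᵀ) = 0 := by
      have hd : (fun i => hA.eigenvalues i * d i) = fun _ => 0 := by
        funext i
        simp [d]
      rw [hspec, conj_mul, hd]
      simp
    exact (conjTranspose_mul_self_mul_eq_zero X _).1 h
  · have hr : X.rank = (Finset.univ.filter fun i => hA.eigenvalues i ≠ 0).card := by
      rw [← rank_transpose_mul_self, hA.rank_eq_card_non_zero_eigs, Fintype.card_subtype]
    have hc := Finset.card_filter_add_card_filter_not (s := (Finset.univ : Finset (Fin N)))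
      (fun i => hA.eigenvalues i = 0)
    rw [trace_mul_comm, ← Matrix.mul_assoc, hU, Matrix.one_mul, trace_diagonal, hr]
    simp only [d, Finset.sum_boole]
    rw [Finset.card_univ, Fintype.card_fin] at hc
    rw [eq_sub_iff_add_eq]
    exact_mod_cast hc

/-- The diagonal entries of an orthogonal projection lie in the unit interval. -/
lemma diag_mem_Icc_of_isIdempotentElem {N : ℕ} {R : Matrix (Fin N) (Fin N) ℝ}
    (hRs : Rᵀ = R) (hRi : R * R = R) (i : Fin N) : R i i ∈ Set.Icc (0 : ℝ) 1 := by
  have h : R i i = ∑ j, R i j ^ 2 := by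
    conv_lhs => rw [← hRi, mul_apply]
    refine Finset.sum_congr rfl fun j _ => ?_
    rw [pow_two, ← congrFun (congrFun hRs j) i, transpose_apply]
  have h1 : R i i ^ 2 ≤ R i i := by
    conv_rhs => rw [h]
    exact Finset.single_le_sum (f := fun j => R i j ^ 2) (fun j _ => sq_nonneg _)
      (Finset.mem_univ i)
  constructor <;> nlinarith [sq_nonneg (R i i)]

/-- A weighted sum of a nonincreasing nonnegative sequence with weights in `[0, 1]` of total
mass at least `N - k` dominates the sum of its `N - k` smallest terms. -/
lemma sum_filter_le_sum_mul {N k : ℕ} (hk : k ≤ N) {a p : Fin N → ℝ} (ha0 : ∀ i, 0 ≤ a i)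
    (ha : Antitone a) (hp : ∀ i, p i ∈ Set.Icc (0 : ℝ) 1) (hsum : (N : ℝ) - k ≤ ∑ i, p i) :
    ∑ i ∈ Finset.univ.filter (fun i : Fin N => k ≤ (i : ℕ)), a i ≤ ∑ i, a i * p i := by
  obtain ⟨s, hs0, hs1, hs2⟩ : ∃ s : ℝ, 0 ≤ s ∧ (∀ i : Fin N, (i : ℕ) < k → s ≤ a i) ∧
      ∀ i : Fin N, k ≤ (i : ℕ) → a i ≤ s := by
    rcases hk.lt_or_eq with h | rfl
    · exact ⟨a ⟨k, h⟩, ha0 _, fun i hi => ha (Fin.le_def.2 hi.le), fun i hi => ha (Fin.le_def.2 hi)⟩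
    · exact ⟨0, le_rfl, fun i _ => ha0 i, fun i hi => absurd i.2 (not_lt.2 hi)⟩
  have hcard : ∑ i : Fin N, (if k ≤ (i : ℕ) then (1 : ℝ) else 0) = N - k := by
    rw [Fin.sum_univ_eq_sum_range (fun i => if k ≤ i then (1 : ℝ) else 0), Finset.sum_boole]
    have : (Finset.range N).filter (fun i => k ≤ i) = Finset.Ico k N := by
      ext i
      simp [and_comm]
    rw [this, Nat.card_Ico, Nat.cast_sub hk]
  have hterm : ∀ i : Fin N, s * (p i - if k ≤ (i : ℕ) then 1 else 0)
      ≤ a i * p i - if k ≤ (i : ℕ) then a i else 0 := fun i => by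
    obtain ⟨h0, h1⟩ := hp i
    split_ifs with h
    · nlinarith [hs2 i h]
    · nlinarith [hs1 i (not_le.1 h)]
  have h := Finset.sum_le_sum fun i (_ : i ∈ Finset.univ) => hterm i
  rw [← Finset.mul_sum, Finset.sum_sub_distrib, Finset.sum_sub_distrib, hcard,
    ← Finset.sum_filter] at h
  linarith [mul_nonneg hs0 (sub_nonneg.2 hsum)]

/-- Eckart–Young–Mirsky theorem in the Frobenius norm: let `σ₁ ≥ … ≥ σ_N ≥ 0`
be the singular values of `B` (so that the `σᵢ²` are the eigenvalues of `BᵀB`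
in nonincreasing order with multiplicity, encoded by an orthogonal
diagonalization `BᵀB = Q diag(σᵢ²) Qᵀ`).  Then every `X` with `rank X ≤ k`
satisfies `‖B − X‖_F² ≥ ∑_{i=k+1}^N σᵢ²`, some `B*` with `rank B* ≤ k`
attains `‖B − B*‖_F² = ∑_{i=k+1}^N σᵢ²`, and hence the minimum of `‖B − X‖_F`
over matrices of rank at most `k` equals `√(∑_{i=k+1}^N σᵢ²)`. -/
theorem stmt13 {N k : ℕ} (hk : k ≤ N)
    (B : Matrix (Fin N) (Fin N) ℝ)
    (σ : Fin N → ℝ) (hσ0 : ∀ i, 0 ≤ σ i) (hσ : Antitone σ)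
    (Q : Matrix (Fin N) (Fin N) ℝ) (hQ : Qᵀ * Q = 1)
    (hdecomp : Bᵀ * B = Q * Matrix.diagonal (fun i => σ i ^ 2) * Qᵀ) :
    (∀ X : Matrix (Fin N) (Fin N) ℝ, X.rank ≤ k →
      ∑ i ∈ Finset.univ.filter (fun i : Fin N => k ≤ (i : ℕ)), σ i ^ 2
        ≤ frobSq (B - X)) ∧
    (∃ Bstar : Matrix (Fin N) (Fin N) ℝ, Bstar.rank ≤ k ∧
      frobSq (B - Bstar)
        = ∑ i ∈ Finset.univ.filter (fun i : Fin N => k ≤ (i : ℕ)), σ i ^ 2) ∧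
    IsLeast
      {t : ℝ | ∃ X : Matrix (Fin N) (Fin N) ℝ, X.rank ≤ k ∧ t = frob (B - X)}
      (Real.sqrt
        (∑ i ∈ Finset.univ.filter (fun i : Fin N => k ≤ (i : ℕ)), σ i ^ 2)) := by
  have hQ' : Q * Qᵀ = 1 := mul_eq_one_comm.1 hQ
  have lower : ∀ X : Matrix (Fin N) (Fin N) ℝ, X.rank ≤ k →
      ∑ i ∈ Finset.univ.filter (fun i : Fin N => k ≤ (i : ℕ)), σ i ^ 2 ≤ frobSq (B - X) := by
    intro X hX
    obtain ⟨P, hPs, hPi, hXP, hPt⟩ := exists_projection_onto_ker X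
    have hRs : (Qᵀ * P * Q)ᵀ = Qᵀ * P * Q := by simp [hPs, Matrix.mul_assoc]
    have hRi : (Qᵀ * P * Q) * (Qᵀ * P * Q) = Qᵀ * P * Q := by
      calc _ = Qᵀ * P * (Q * Qᵀ) * P * Q := by simp only [Matrix.mul_assoc]
        _ = _ := by rw [hQ', Matrix.mul_one, Matrix.mul_assoc Qᵀ, hPi]
    have hRt : (N : ℝ) - k ≤ ∑ i, (Qᵀ * P * Q) i i := by
      have h : trace (Qᵀ * P * Q) = N - X.rank := by
        rw [trace_mul_comm, ← Matrix.mul_assoc, hQ', Matrix.one_mul, hPt]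
      have h' : (X.rank : ℝ) ≤ k := by exact_mod_cast hX
      change _ ≤ trace (Qᵀ * P * Q)
      linarith
    calc _ ≤ ∑ i, σ i ^ 2 * (Qᵀ * P * Q) i i :=
          sum_filter_le_sum_mul hk (fun i => sq_nonneg _)
            (fun i j hij => pow_le_pow_left₀ (hσ0 j) (hσ hij) 2)
            (diag_mem_Icc_of_isIdempotentElem hRs hRi) hRt
      _ = trace (diagonal (fun i => σ i ^ 2) * (Qᵀ * P * Q)) := by simp [trace]
      _ = trace (Bᵀ * B * P) := by
          rw [hdecomp, ← Matrix.mul_assoc, trace_mul_comm]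
          simp only [Matrix.mul_assoc]
      _ = frobSq ((B - X) * P) := by
          rw [← frobSq_mul_of_isIdempotentElem B hPs hPi, Matrix.sub_mul, hXP, sub_zero]
      _ ≤ frobSq (B - X) := frobSq_mul_le_of_isIdempotentElem _ hPs hPi
  have attained : ∃ Bstar : Matrix (Fin N) (Fin N) ℝ, Bstar.rank ≤ k ∧ frobSq (B - Bstar)
      = ∑ i ∈ Finset.univ.filter (fun i : Fin N => k ≤ (i : ℕ)), σ i ^ 2 := by
    set e : Fin N → ℝ := fun i => if k ≤ (i : ℕ) then 1 else 0
    have hPs : (Q * diagonal e * Qᵀ)ᵀ = Q * diagonal e * Qᵀ := by simp [Matrix.mul_assoc]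
    have hPi : (Q * diagonal e * Qᵀ) * (Q * diagonal e * Qᵀ) = Q * diagonal e * Qᵀ := by
      calc _ = Q * diagonal e * (Qᵀ * Q) * diagonal e * Qᵀ := by simp only [Matrix.mul_assoc]
        _ = _ := by
          rw [hQ, Matrix.mul_one, Matrix.mul_assoc Q, diagonal_mul_diagonal]
          congr 3
          funext i
          simp [e]
    refine ⟨B * (Q * diagonal (1 - e) * Qᵀ), ?_, ?_⟩
    · calc (B * (Q * diagonal (1 - e) * Qᵀ)).rank
        _ ≤ (diagonal (1 - e)).rank :=
          (rank_mul_le_right _ _).trans ((rank_mul_le_left _ _).trans (rank_mul_le_right _ _))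
        _ = (Finset.univ.filter fun i => (1 - e) i ≠ 0).card := by
          rw [rank_diagonal, Fintype.card_subtype]
        _ ≤ (Finset.range k).card := by
          refine Finset.card_le_card_of_injOn (fun i => (i : ℕ)) (fun i hi => ?_)
            (fun i _ j _ h => Fin.ext h)
          by_contra h
          have h' : k ≤ (i : ℕ) := by simpa using h
          simp [e, h'] at hi
        _ = k := Finset.card_range k
    · have h : B - B * (Q * diagonal (1 - e) * Qᵀ) = B * (Q * diagonal e * Qᵀ) := by
        have : diagonal (1 - e) = 1 - diagonal e := by
          rw [← diagonal_one, diagonal_sub]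
          rfl
        rw [this, Matrix.mul_sub, Matrix.mul_one, Matrix.sub_mul, hQ', Matrix.mul_sub,
          Matrix.mul_one, sub_sub_cancel]
      rw [h, frobSq_mul_of_isIdempotentElem B hPs hPi, hdecomp]
      calc _ = trace (Q * (diagonal (fun i => σ i ^ 2) * (Qᵀ * Q) * diagonal e * Qᵀ)) := by
            simp only [Matrix.mul_assoc]
        _ = trace (diagonal (fun i => σ i ^ 2 * e i)) := by
            rw [trace_mul_comm, hQ, Matrix.mul_one, Matrix.mul_assoc, hQ, Matrix.mul_one,
              diagonal_mul_diagonal]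
        _ = _ := by simp [e, Finset.sum_filter]
  refine ⟨lower, attained, ?_, ?_⟩
  · obtain ⟨Bstar, hr, hB⟩ := attained
    exact ⟨Bstar, hr, congrArg Real.sqrt hB.symm⟩
  · rintro t ⟨X, hX, rfl⟩
    exact Real.sqrt_le_sqrt (lower X hX)
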